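/- arXiv:1402.1272 — 2 statements merged into one kernel-verified Lean document; each statement's English description precedes it below -/
import Mathlib

section
/- For every γ with 0 < γ ≤ 1, the class of functions on [0,1)² of bounded {n^γ}#-variation coincides with the class of functions continuous in {n^γ}#-variation: {n^γ}#V = C{n^γ}#V. -/
open MeasureTheory Filter Set ENNReal

noncomputable section

/-- The basic Rademacher-type function: 1 on [0,1/2), -1 on [1/2,1), 1-periodic. -/
def r0 (x : ℝ) : ℝ := if Int.fract x < 1/2 then 1 else -1

/-- The Walsh functions: products of Rademacher functions according to binary digits. -/
def walsh (k : ℕ) (x : ℝ) : ℝ :=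
  ∏ j ∈ Finset.range k, if k.testBit j then r0 (2 ^ j * x) else 1

/-- The Walsh–Dirichlet kernel `D_n`. -/
def walshDirichlet (n : ℕ) (x : ℝ) : ℝ :=
  ∑ k ∈ Finset.range n, walsh k x

/-- A finite ordered family of nonoverlapping subintervals of `[0,1)`. -/
structure IntervalPack (n : ℕ) where
  a : Fin n → ℝ
  b : Fin n → ℝ
  ha : ∀ i, 0 ≤ a i
  hab : ∀ i, a i < b i
  hb : ∀ i, b i ≤ 1
  disj : ∀ i j, i ≠ j → Disjoint (Ioo (a i) (b i)) (Ioo (a j) (b j))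

/-- A family of nonoverlapping intervals together with a point `y i` for each interval. -/
structure SharpPack (n : ℕ) extends IntervalPack n where
  y : Fin n → ℝ
  hy : ∀ i, y i ∈ Ico (0:ℝ) 1

/-- The `Λ^#`-variation sum of `f` over a pack, with weight sequence shifted by `m`
(weight `Λ (m+i)` for the `i`-th interval, `1`-based). -/
def sharpSum {n : ℕ} (Λ : ℕ → ℝ) (m : ℕ) (f : ℝ → ℝ → ℝ) (P : SharpPack n) : ℝ≥0∞ :=
  ∑ i : Fin n, ENNReal.ofReal
    (|f (P.b i) (P.y i) - f (P.a i) (P.y i)| / Λ (m + i.1 + 1))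

/-- `Λ_m^# V_1 (f)`. -/
def sharpV1 (Λ : ℕ → ℝ) (m : ℕ) (f : ℝ → ℝ → ℝ) : ℝ≥0∞ :=
  ⨆ (n : ℕ) (P : SharpPack n), sharpSum Λ m f P

/-- `Λ_m^# V_2 (f)`. -/
def sharpV2 (Λ : ℕ → ℝ) (m : ℕ) (f : ℝ → ℝ → ℝ) : ℝ≥0∞ :=
  sharpV1 Λ m (fun x y => f y x)

/-- `Λ_m^# V (f) = Λ_m^# V_1 (f) + Λ_m^# V_2 (f)`. -/
def sharpV (Λ : ℕ → ℝ) (m : ℕ) (f : ℝ → ℝ → ℝ) : ℝ≥0∞ :=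
  sharpV1 Λ m f + sharpV2 Λ m f

/-- `f ∈ Λ^# BV`: bounded `Λ^#`-variation. -/
def SharpBV (Λ : ℕ → ℝ) (f : ℝ → ℝ → ℝ) : Prop := sharpV Λ 0 f ≠ ⊤

/-- `f ∈ C Λ^# V`: continuity in `Λ^#`-variation, i.e. `Λ_m^# V (f) → 0`. -/
def CSharpV (Λ : ℕ → ℝ) (f : ℝ → ℝ → ℝ) : Prop :=
  Tendsto (fun m => sharpV Λ m f) atTop (nhds 0)

/-- `v_1^#(n, f)`: supremum of sums of `n` increments over `n` nonoverlapping
intervals, with freely chosen points `y_i`. -/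
def vSharp1 (f : ℝ → ℝ → ℝ) (n : ℕ) : ℝ≥0∞ :=
  ⨆ (P : SharpPack n), ∑ i : Fin n,
    ENNReal.ofReal |f (P.b i) (P.y i) - f (P.a i) (P.y i)|

def vSharp2 (f : ℝ → ℝ → ℝ) (n : ℕ) : ℝ≥0∞ := vSharp1 (fun x y => f y x) n

/-- `Λ V_1 (f)`: one fixed `y` for the whole family of intervals. -/
def lineV1 (Λ : ℕ → ℝ) (f : ℝ → ℝ → ℝ) : ℝ≥0∞ :=
  ⨆ (n : ℕ) (y : Ico (0:ℝ) 1) (P : IntervalPack n),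
    ∑ i : Fin n, ENNReal.ofReal (|f (P.b i) (y : ℝ) - f (P.a i) (y : ℝ)| / Λ (i.1 + 1))

def lineV2 (Λ : ℕ → ℝ) (f : ℝ → ℝ → ℝ) : ℝ≥0∞ := lineV1 Λ (fun x y => f y x)

/-- The mixed `(Λ¹,Λ²)`-variation `(Λ¹Λ²) V_{1,2}(f)`. -/
def mixedV (Λ₁ Λ₂ : ℕ → ℝ) (f : ℝ → ℝ → ℝ) : ℝ≥0∞ :=
  ⨆ (n : ℕ) (m : ℕ) (P : IntervalPack n) (Q : IntervalPack m),
    ∑ i : Fin n, ∑ j : Fin m, ENNReal.ofReal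
      (|f (P.a i) (Q.a j) - f (P.a i) (Q.b j) - f (P.b i) (Q.a j) + f (P.b i) (Q.b j)| /
        (Λ₁ (i.1 + 1) * Λ₂ (j.1 + 1)))

/-- Harmonic bounded variation `HBV` in the sense of Hardy–Krause/Waterman type. -/
def HBV (f : ℝ → ℝ → ℝ) : Prop :=
  lineV1 (fun n => (n : ℝ)) f + lineV2 (fun n => (n : ℝ)) f +
    mixedV (fun n => (n : ℝ)) (fun n => (n : ℝ)) f ≠ ⊤

/-- A finite family of nonoverlapping rectangles in `[0,1)²`. -/
structure RectPack (n : ℕ) where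
  a : Fin n → ℝ
  b : Fin n → ℝ
  c : Fin n → ℝ
  d : Fin n → ℝ
  ha : ∀ i, 0 ≤ a i
  hab : ∀ i, a i < b i
  hb : ∀ i, b i ≤ 1
  hc : ∀ i, 0 ≤ c i
  hcd : ∀ i, c i < d i
  hd : ∀ i, d i ≤ 1
  disj : ∀ i j, i ≠ j →
    Disjoint (Ioo (a i) (b i) ×ˢ Ioo (c i) (d i)) (Ioo (a j) (b j) ×ˢ Ioo (c j) (d j))

/-- The Dyachenko–Waterman rectangular variation `Λ* V (f)`. -/
def rectV (Λ : ℕ → ℝ) (f : ℝ → ℝ → ℝ) : ℝ≥0∞ :=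
  ⨆ (n : ℕ) (R : RectPack n), ∑ i : Fin n, ENNReal.ofReal
    (|f (R.a i) (R.c i) - f (R.a i) (R.d i) - f (R.b i) (R.c i) + f (R.b i) (R.d i)| /
      Λ (i.1 + 1))

/-- `q_N = 4^0 + 4^1 + ⋯ + 4^{N-1}`. -/
def qIdx (N : ℕ) : ℕ := ∑ k ∈ Finset.range N, 4 ^ k

/-- The tent function `φ_{N,j}` of height 1 on `[j 2^{-2N}, (j+1) 2^{-2N}]`. -/
def tent (N j : ℕ) (x : ℝ) : ℝ :=
  max 0 (1 - |2 ^ (2 * N + 1) * x - (2 * j + 1)|)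

/-- `φ_N = ∑_{j=1}^{2^{2N}-1} φ_{N,j}`. -/
def tentSum (N : ℕ) (x : ℝ) : ℝ :=
  ∑ j ∈ Finset.Icc 1 (2 ^ (2 * N) - 1), tent N j x

/-- `A_n^α = (α+1)(α+2)⋯(α+n)/n!`. -/
def Acoef (α : ℝ) (n : ℕ) : ℝ :=
  (∏ k ∈ Finset.range n, (α + k + 1)) / n.factorial

/-- The Cesàro `(C,α)` kernel for the Walsh system. -/
def cesaroKernel (α : ℝ) (n : ℕ) (x : ℝ) : ℝ :=
  (Acoef α (n - 1))⁻¹ * ∑ k ∈ Finset.Icc 1 n, Acoef (α - 1) (n - k) * walshDirichlet k x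

/-- The `(n,m)`-th Walsh–Fourier coefficient of `f`. -/
def fourierCoef (f : ℝ → ℝ → ℝ) (n m : ℕ) : ℝ :=
  ∫ x in (0:ℝ)..1, ∫ y in (0:ℝ)..1, f x y * walsh n x * walsh m y

/-- The rectangular partial sums of the double Walsh–Fourier series of `f`. -/
def partialSum (f : ℝ → ℝ → ℝ) (M N : ℕ) (x y : ℝ) : ℝ :=
  ∑ m ∈ Finset.range M, ∑ n ∈ Finset.range N, fourierCoef f m n * walsh m x * walsh n y

/-- The Cesàro `(C;α,β)` means of the double Walsh–Fourier series of `f`. -/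
def cesaroMean (α β : ℝ) (n m : ℕ) (f : ℝ → ℝ → ℝ) (x y : ℝ) : ℝ :=
  (Acoef α (n - 1) * Acoef β (m - 1))⁻¹ *
    ∑ i ∈ Finset.Icc 1 n, ∑ j ∈ Finset.Icc 1 m,
      Acoef (α - 1) (n - i) * Acoef (β - 1) (m - j) * partialSum f i j x y

/-- The sup norm of `f` over `[0,1]²` (in `ℝ≥0∞`). -/
def supNorm (f : ℝ → ℝ → ℝ) : ℝ≥0∞ :=
  ⨆ (x : Icc (0:ℝ) 1) (y : Icc (0:ℝ) 1), ENNReal.ofReal |f x y|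

/-- The norm `‖f‖_C + Λ^# V (f)` on `C ∩ Λ^# BV` (in `ℝ≥0∞`). -/
def bvNorm (Λ : ℕ → ℝ) (f : ℝ → ℝ → ℝ) : ℝ≥0∞ :=
  supNorm f + sharpV Λ 0 f

end

/-! ### Weighted sums over lists -/

section WeightedSum

variable {α : Type*} {w : ℕ → ℝ≥0∞} {g : α → ℝ≥0∞}

/-- The sum `∑ g (L i) * w (m + i)` over a list `L`. -/
noncomputable def weightedSum (w : ℕ → ℝ≥0∞) (g : α → ℝ≥0∞) : ℕ → List α → ℝ≥0∞
  | _, [] => 0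
  | m, t :: L => g t * w m + weightedSum w g (m + 1) L

theorem weightedSum_append (m : ℕ) (L L' : List α) :
    weightedSum w g m (L ++ L') = weightedSum w g m L + weightedSum w g (m + L.length) L' := by
  induction L generalizing m with
  | nil => simp [weightedSum]
  | cons t L ih =>
    simp only [List.cons_append, weightedSum, ih, List.length_cons, add_assoc]
    rw [add_comm 1 L.length]

theorem weightedSum_antitone (hw : Antitone w) (L : List α) :
    Antitone fun m => weightedSum w g m L := by
  induction L with
  | nil => intro m m' _; simp [weightedSum]
  | cons t L ih =>
    intro m m' h
    simp only [weightedSum]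
    exact add_le_add (mul_le_mul_right (hw h) _) (ih (Nat.add_le_add_right h 1))

theorem weightedSum_le_filter_add_filter (hw : Antitone w) (p : α → Prop) [DecidablePred p]
    (m : ℕ) (L : List α) :
    weightedSum w g m L ≤ weightedSum w g m (L.filter fun t => p t) +
      weightedSum w g m (L.filter fun t => ¬ p t) := by
  induction L generalizing m with
  | nil => simp [weightedSum]
  | cons t L ih =>
    have hstep := fun L' : List α => weightedSum_antitone (g := g) hw L' (Nat.le_succ m)
    by_cases h : p t
    · simp only [h, List.filter_cons, weightedSum, decide_true, if_true, not_true_eq_false,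
        decide_false, Bool.false_eq_true, if_false, add_assoc]
      gcongr
      exact (ih (m + 1)).trans (add_le_add le_rfl (hstep _))
    · simp only [h, List.filter_cons, weightedSum, decide_true, if_true, not_false_eq_true,
        decide_false, Bool.false_eq_true, if_false]
      rw [add_left_comm]
      gcongr
      exact (ih (m + 1)).trans (add_le_add (hstep _) le_rfl)

/-- Splitting a list into its entries of even and of odd index doubles the rate at which the
weights are used up. -/
theorem exists_perm_append_mul_weightedSum_le (hw : Antitone w) {q : ℝ≥0∞}
    (hq : ∀ M, 1 ≤ M → q * w (2 * M) ≤ w M) (M : ℕ) (hM : 1 ≤ M) :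
    ∀ L : List α, ∃ L₁ L₂ : List α, L.Perm (L₁ ++ L₂) ∧
      q * weightedSum w g (2 * M) L ≤ weightedSum w g M L₁ + weightedSum w g M L₂
  | [] => ⟨[], [], by simp, by simp [weightedSum]⟩
  | [t] => by
    refine ⟨[t], [], by simp, ?_⟩
    simp only [weightedSum, add_zero]
    rw [mul_left_comm]
    exact mul_le_mul_right (hq M hM) _
  | s :: t :: L => by
    obtain ⟨L₁, L₂, hperm, hle⟩ :=
      exists_perm_append_mul_weightedSum_le hw hq (M + 1) (by omega) L
    refine ⟨s :: L₁, t :: L₂, ?_, ?_⟩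
    · exact ((hperm.cons t).trans List.perm_middle.symm).cons s
    · have hs : q * (g s * w (2 * M)) ≤ g s * w M := by
        rw [mul_left_comm]
        exact mul_le_mul_right (hq M hM) _
      have ht : q * (g t * w (2 * M + 1)) ≤ g t * w M := by
        rw [mul_left_comm]
        exact mul_le_mul_right ((mul_le_mul_right (hw (Nat.le_succ _)) q).trans (hq M hM)) _
      simp only [weightedSum, mul_add]
      calc _ ≤ g s * w M + (g t * w M +
            (weightedSum w g (M + 1) L₁ + weightedSum w g (M + 1) L₂)) :=
            add_le_add hs (add_le_add ht hle)
        _ = _ := by ring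

theorem weightedSum_ofFn {n : ℕ} (m : ℕ) (h : Fin n → α) :
    weightedSum w g m (List.ofFn h) = ∑ i, g (h i) * w (m + i) := by
  induction n generalizing m with
  | zero => simp [weightedSum]
  | succ n ih =>
    simp only [List.ofFn_succ, weightedSum, ih, Fin.sum_univ_succ, Fin.val_zero, Fin.val_succ,
      add_zero, add_assoc, add_comm 1]

end WeightedSum

/-! ### Lists of nonoverlapping intervals with marked points -/

/-- The open interval `(a, b)` of a marked interval `(a, b, y)`. -/
def markedIoo (t : ℝ × ℝ × ℝ) : Set ℝ := Ioo t.1 t.2.1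

/-- `L` lists nonoverlapping subintervals of `[0,1)`, each with a marked point of `[0,1)`. -/
def IsSharpList (L : List (ℝ × ℝ × ℝ)) : Prop :=
  (∀ t ∈ L, 0 ≤ t.1 ∧ t.1 < t.2.1 ∧ t.2.1 ≤ 1 ∧ t.2.2 ∈ Ico (0 : ℝ) 1) ∧
    L.Pairwise fun s t => Disjoint (markedIoo s) (markedIoo t)

namespace IsSharpList

variable {L L' : List (ℝ × ℝ × ℝ)}

theorem sublist (hL : IsSharpList L) (h : L'.Sublist L) : IsSharpList L' :=
  ⟨fun t ht => hL.1 t (h.subset ht), hL.2.sublist h⟩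

theorem perm (hL : IsSharpList L) (h : L.Perm L') : IsSharpList L' :=
  ⟨fun t ht => hL.1 t (h.mem_iff.2 ht), (h.pairwise_iff fun h => h.symm).1 hL.2⟩

theorem append (hL : IsSharpList L) (hL' : IsSharpList L')
    (h : ∀ s ∈ L, ∀ t ∈ L', Disjoint (markedIoo s) (markedIoo t)) : IsSharpList (L ++ L') := by
  refine ⟨fun t ht => ?_, List.pairwise_append.2 ⟨hL.2, hL'.2, h⟩⟩
  rcases List.mem_append.1 ht with ht | ht
  exacts [hL.1 t ht, hL'.1 t ht]

end IsSharpList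

/-- The supremum of the weighted sums over all lists of nonoverlapping marked intervals. -/
noncomputable def listVar (w : ℕ → ℝ≥0∞) (g : ℝ × ℝ × ℝ → ℝ≥0∞) (m : ℕ) : ℝ≥0∞ :=
  ⨆ (L : List (ℝ × ℝ × ℝ)) (_ : IsSharpList L), weightedSum w g m L

section ListVar

variable {w : ℕ → ℝ≥0∞} {g : ℝ × ℝ × ℝ → ℝ≥0∞}

theorem IsSharpList.weightedSum_le_listVar {L : List (ℝ × ℝ × ℝ)} (hL : IsSharpList L) (m : ℕ) :
    weightedSum w g m L ≤ listVar w g m :=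
  le_iSup₂ (f := fun L (_ : IsSharpList L) => weightedSum w g m L) L hL

theorem listVar_antitone (hw : Antitone w) : Antitone (listVar w g) :=
  fun _ _ h => iSup₂_mono fun L _ => weightedSum_antitone hw L h

theorem IsSharpList.mul_le_listVar {L : List (ℝ × ℝ × ℝ)} (hL : IsSharpList L) {t : ℝ × ℝ × ℝ}
    (ht : t ∈ L) (m : ℕ) : g t * w m ≤ listVar w g m := by
  simpa [weightedSum] using
    (hL.sublist (List.singleton_sublist.2 ht)).weightedSum_le_listVar (w := w) (g := g) m

/-- Intervals that contain a point of a finite set in their interior contribute little. -/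
theorem IsSharpList.exists_sublist_avoiding (hw : Antitone w) (E : List ℝ) (m : ℕ) {K : ℝ≥0∞}
    {Q : List (ℝ × ℝ × ℝ)} (hQ : IsSharpList Q) (hK : ∀ t ∈ Q, g t ≤ K) :
    ∃ Q' : List (ℝ × ℝ × ℝ), Q'.Sublist Q ∧ (∀ t ∈ Q', ∀ e ∈ E, e ∉ markedIoo t) ∧
      weightedSum w g m Q ≤ weightedSum w g m Q' + E.length * (K * w m) := by
  classical
  induction E with
  | nil => exact ⟨Q, List.Sublist.refl Q, by simp, by simp⟩
  | cons e E ih =>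
    obtain ⟨Q', hsub, havoid, hle⟩ := ih
    have hone : weightedSum w g m (Q'.filter fun t => e ∈ markedIoo t) ≤ K * w m := by
      have hmem : ∀ t ∈ Q'.filter (fun t => e ∈ markedIoo t), t ∈ Q ∧ e ∈ markedIoo t := by
        intro t ht
        rw [List.mem_filter, decide_eq_true_iff] at ht
        exact ⟨hsub.subset ht.1, ht.2⟩
      have hpw := (hQ.sublist (List.filter_sublist.trans hsub) :
        IsSharpList (Q'.filter fun t => e ∈ markedIoo t)).2
      revert hmem hpw
      rcases Q'.filter (fun t => e ∈ markedIoo t) with _ | ⟨s, _ | ⟨t, L⟩⟩ <;> intro hmem hpw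
      · simp [weightedSum]
      · simpa [weightedSum] using mul_le_mul_left (hK s (hmem s (by simp)).1) (w m)
      · exact absurd (hmem t (by simp)).2
          (Set.disjoint_left.1 (List.rel_of_pairwise_cons hpw (by simp)) (hmem s (by simp)).2)
    refine ⟨Q'.filter fun t => ¬ e ∈ markedIoo t, List.filter_sublist.trans hsub, ?_, ?_⟩
    · intro t ht e' he'
      rw [List.mem_filter, decide_eq_true_iff] at ht
      rcases List.mem_cons.1 he' with rfl | he'
      exacts [ht.2, havoid t ht.1 e' he']
    · calc weightedSum w g m Q ≤ weightedSum w g m Q' + E.length * (K * w m) := hle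
        _ ≤ (K * w m + weightedSum w g m (Q'.filter fun t => ¬ e ∈ markedIoo t)) +
            E.length * (K * w m) := by
          gcongr
          exact (weightedSum_le_filter_add_filter hw (fun t => e ∈ markedIoo t) m Q').trans
            (add_le_add hone le_rfl)
        _ = _ := by
          rw [List.length_cons]
          push_cast
          ring

/-- An open interval containing neither endpoint of another one that it meets lies inside it. -/
theorem markedIoo_subset_of_not_disjoint {s t : ℝ × ℝ × ℝ}
    (h : ¬ Disjoint (markedIoo s) (markedIoo t))
    (h₁ : s.1 ∉ markedIoo t) (h₂ : s.2.1 ∉ markedIoo t) : markedIoo t ⊆ markedIoo s := by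
  obtain ⟨x, hs, ht⟩ := Set.not_disjoint_iff.1 h
  simp only [markedIoo, mem_Ioo, not_and_or, not_lt] at *
  have h₁' : s.1 ≤ t.1 := by
    rcases h₁ with h₁ | h₁ <;> linarith
  have h₂' : t.2.1 ≤ s.2.1 := by
    rcases h₂ with h₂ | h₂ <;> linarith
  exact Ioo_subset_Ioo h₁' h₂'

theorem mul_weightedSum_add_weightedSum_le (hw : Antitone w) {q : ℝ≥0∞}
    (hq : ∀ M, 1 ≤ M → q * w (2 * M) ≤ w M) {M m : ℕ} (hM : 1 ≤ M) {K : ℝ≥0∞}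
    (hK : ∀ L, IsSharpList L → ∀ t ∈ L, g t ≤ K) {P Q : List (ℝ × ℝ × ℝ)} (hP : IsSharpList P)
    (hQ : IsSharpList Q) (hm : M + P.length ≤ m) :
    q * weightedSum w g (2 * M) P + weightedSum w g m Q ≤
      2 * listVar w g M + (2 * P.length : ℕ) * (K * w m) := by
  classical
  obtain ⟨P₁, P₂, hperm, hPle⟩ :=
    exists_perm_append_mul_weightedSum_le (g := g) hw hq M hM P
  have hP' := hP.perm hperm
  have hlen : P.length = P₁.length + P₂.length := by simpa using hperm.length_eq
  obtain ⟨Q', hsub, havoid, hQle⟩ := hQ.exists_sublist_avoiding (g := g) hw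
    (P.map (fun t => t.1) ++ P.map (fun t => t.2.1)) m (hK Q hQ)
  have hQ' := hQ.sublist hsub
  have hin : ∀ s ∈ P₁ ++ P₂, ∀ t ∈ Q', ¬ Disjoint (markedIoo s) (markedIoo t) →
      markedIoo t ⊆ markedIoo s := by
    intro s hs t ht h
    have hs' := hperm.mem_iff.2 hs
    refine markedIoo_subset_of_not_disjoint h (havoid t ht _ ?_) (havoid t ht _ ?_)
    · exact List.mem_append_left _ (List.mem_map_of_mem hs')
    · exact List.mem_append_right _ (List.mem_map_of_mem (f := fun t => t.2.1) hs')
  let p : ℝ × ℝ × ℝ → Prop := fun t => ∃ s ∈ P₁, ¬ Disjoint (markedIoo s) (markedIoo t)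
  have hP₁ : IsSharpList P₁ := hP'.sublist (List.sublist_append_left _ _)
  have hP₂ : IsSharpList P₂ := hP'.sublist (List.sublist_append_right _ _)
  have hA : weightedSum w g M P₂ + weightedSum w g m (Q'.filter fun t => p t) ≤
      listVar w g M := by
    have hv : IsSharpList (P₂ ++ Q'.filter fun t => p t) := by
      refine hP₂.append (hQ'.sublist List.filter_sublist) fun s hs t ht => ?_
      rw [List.mem_filter, decide_eq_true_iff] at ht
      obtain ⟨ht, r, hr, hrt⟩ := ht
      exact ((List.pairwise_append.1 hP'.2).2.2 r hr s hs).symm.mono_right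
        (hin r (List.mem_append_left _ hr) t ht hrt)
    refine le_trans ?_ (hv.weightedSum_le_listVar M)
    rw [weightedSum_append]
    exact add_le_add le_rfl (weightedSum_antitone hw _ (by omega))
  have hB : weightedSum w g M P₁ + weightedSum w g m (Q'.filter fun t => ¬ p t) ≤
      listVar w g M := by
    have hv : IsSharpList (P₁ ++ Q'.filter fun t => ¬ p t) := by
      refine hP₁.append (hQ'.sublist List.filter_sublist) fun s hs t ht => ?_
      rw [List.mem_filter, decide_eq_true_iff] at ht
      by_contra h
      exact ht.2 ⟨s, hs, h⟩
    refine le_trans ?_ (hv.weightedSum_le_listVar M)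
    rw [weightedSum_append]
    exact add_le_add le_rfl (weightedSum_antitone hw _ (by omega))
  rw [List.length_append, List.length_map, List.length_map, ← two_mul] at hQle
  calc _ ≤ (weightedSum w g M P₁ + weightedSum w g M P₂) +
        ((weightedSum w g m (Q'.filter fun t => p t) +
          weightedSum w g m (Q'.filter fun t => ¬ p t)) + (2 * P.length : ℕ) * (K * w m)) := by
        refine add_le_add hPle (hQle.trans ?_)
        gcongr
        exact weightedSum_le_filter_add_filter hw p m Q'
    _ = (weightedSum w g M P₂ + weightedSum w g m (Q'.filter fun t => p t)) +
        (weightedSum w g M P₁ + weightedSum w g m (Q'.filter fun t => ¬ p t)) +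
          (2 * P.length : ℕ) * (K * w m) := by ring
    _ ≤ _ := by
      rw [two_mul (listVar w g M)]
      exact add_le_add (add_le_add hA hB) le_rfl

theorem isSharpList_nil : IsSharpList [] := by simp [IsSharpList]

theorem mul_iInf_listVar_add_le (hw : Antitone w) (hw0 : w 0 ≠ 0)
    (hlim : Tendsto w atTop (nhds 0)) {q : ℝ≥0∞} (hq : ∀ M, 1 ≤ M → q * w (2 * M) ≤ w M)
    (hfin : listVar w g 0 ≠ ⊤) {M : ℕ} (hM : 1 ≤ M) :
    q * (⨅ m, listVar w g m) + (⨅ m, listVar w g m) ≤ 2 * listVar w g M := by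
  set δ : ℝ≥0∞ := ⨅ m, listVar w g m
  have hKfin : listVar w g 0 / w 0 ≠ ⊤ := ENNReal.div_ne_top hfin hw0
  have hK : ∀ L, IsSharpList L → ∀ t ∈ L, g t ≤ listVar w g 0 / w 0 := fun L hL t ht =>
    (ENNReal.le_div_iff_mul_le (Or.inl hw0) (Or.inr hfin)).2 (hL.mul_le_listVar ht 0)
  have hne : ∃ L, IsSharpList L := ⟨[], isSharpList_nil⟩
  have hstep : ∀ P, IsSharpList P → q * weightedSum w g (2 * M) P + δ ≤ 2 * listVar w g M := by
    intro P hP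
    have herr : Tendsto (fun m => 2 * listVar w g M +
        (2 * P.length : ℕ) * (listVar w g 0 / w 0 * w m)) atTop (nhds (2 * listVar w g M)) := by
      have h₁ := ENNReal.Tendsto.const_mul hlim (Or.inr hKfin)
      rw [mul_zero] at h₁
      have h₂ := ENNReal.Tendsto.const_mul h₁ (Or.inr (ENNReal.natCast_ne_top (2 * P.length)))
      rw [mul_zero] at h₂
      simpa using h₂.const_add (2 * listVar w g M)
    refine ge_of_tendsto herr ?_
    filter_upwards [eventually_ge_atTop (M + P.length)] with m hm
    calc _ ≤ q * weightedSum w g (2 * M) P + listVar w g m :=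
          add_le_add le_rfl (iInf_le _ m)
      _ ≤ _ := by
        rw [listVar, ENNReal.add_biSup' hne]
        exact iSup₂_le fun Q hQ =>
          mul_weightedSum_add_weightedSum_le hw hq hM hK hP hQ hm
  calc q * δ + δ ≤ q * listVar w g (2 * M) + δ := by
        gcongr
        exact iInf_le _ _
    _ ≤ _ := by
      rw [listVar.eq_def w g (2 * M)]
      simp only [ENNReal.mul_iSup]
      rw [ENNReal.biSup_add' hne]
      exact iSup₂_le hstep

theorem tendsto_listVar_zero (hw : Antitone w) (hw0 : w 0 ≠ 0)
    (hlim : Tendsto w atTop (nhds 0)) {q : ℝ≥0∞} (hq1 : 1 < q)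
    (hq : ∀ M, 1 ≤ M → q * w (2 * M) ≤ w M) (hfin : listVar w g 0 ≠ ⊤) :
    Tendsto (listVar w g) atTop (nhds 0) := by
  have htend := tendsto_atTop_iInf (listVar_antitone (g := g) hw)
  have hδfin : (⨅ m, listVar w g m) ≠ ⊤ := ne_top_of_le_ne_top hfin (iInf_le _ 0)
  have hle := ge_of_tendsto (ENNReal.Tendsto.const_mul htend (Or.inr (by simp)))
    ((eventually_ge_atTop 1).mono fun M hM => mul_iInf_listVar_add_le hw hw0 hlim hq hfin hM)
  rw [two_mul, ENNReal.add_le_add_iff_right hδfin] at hle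
  suffices h : (⨅ m, listVar w g m) = 0 by rwa [h] at htend
  by_contra h
  have := ENNReal.mul_lt_mul_left h hδfin hq1
  rw [one_mul] at this
  exact absurd hle this.not_ge

theorem listVar_zero_ne_top (hw0 : ∀ m, w m ≠ 0) (hwtop : ∀ m, w m ≠ ⊤) {m : ℕ}
    (hm : listVar w g m ≠ ⊤) : listVar w g 0 ≠ ⊤ := by
  induction m with
  | zero => exact hm
  | succ m ih =>
    refine ih (ne_top_of_le_ne_top (b := listVar w g (m + 1) / w (m + 1) * w m +
      listVar w g (m + 1)) ?_ (iSup₂_le fun L hL => ?_))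
    · exact ENNReal.add_ne_top.2
        ⟨ENNReal.mul_ne_top (ENNReal.div_ne_top hm (hw0 _)) (hwtop _), hm⟩
    · rcases L with _ | ⟨t, L⟩
      · simp [weightedSum]
      · refine add_le_add ?_ ((hL.sublist (List.sublist_cons_self t L)).weightedSum_le_listVar _)
        gcongr
        exact (ENNReal.le_div_iff_mul_le (Or.inl (hw0 _)) (Or.inr hm)).2
          (hL.mul_le_listVar (by simp) _)

end ListVar

/-! ### Power weights -/

/-- The weights `1 / λ_{m+1}` of a sequence `λ`. -/
noncomputable def invWeight (Λ : ℕ → ℝ) (m : ℕ) : ℝ≥0∞ := ENNReal.ofReal (Λ (m + 1))⁻¹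

theorem sharpV1_eq_listVar (Λ : ℕ → ℝ) (m : ℕ) (f : ℝ → ℝ → ℝ) :
    sharpV1 Λ m f =
      listVar (invWeight Λ) (fun t => ENNReal.ofReal |f t.2.1 t.2.2 - f t.1 t.2.2|) m := by
  have hterm : ∀ (x : ℝ) (k : ℕ), ENNReal.ofReal (|x| / Λ (k + 1)) =
      ENNReal.ofReal |x| * invWeight Λ k := fun x k => by
    rw [div_eq_mul_inv, ENNReal.ofReal_mul (abs_nonneg x), invWeight]
  apply le_antisymm
  · refine iSup₂_le fun n P => ?_
    have hL : IsSharpList (List.ofFn fun i => (P.a i, P.b i, P.y i)) := by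
      refine ⟨List.forall_mem_ofFn_iff.2 fun i => ⟨P.ha i, P.hab i, P.hb i, P.hy i⟩,
        List.pairwise_ofFn.2 fun i j hij => P.disj i j hij.ne⟩
    refine le_trans (le_of_eq ?_) (hL.weightedSum_le_listVar m)
    rw [weightedSum_ofFn]
    exact Finset.sum_congr rfl fun i _ => hterm _ _
  · refine iSup₂_le fun L hL => ?_
    have hdisj : ∀ i j : Fin L.length, i < j →
        Disjoint (markedIoo (L.get i)) (markedIoo (L.get j)) :=
      List.pairwise_iff_get.1 hL.2
    let P : SharpPack L.length :=
      { a := fun i => (L.get i).1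
        b := fun i => (L.get i).2.1
        y := fun i => (L.get i).2.2
        ha := fun i => (hL.1 _ (L.get_mem i)).1
        hab := fun i => (hL.1 _ (L.get_mem i)).2.1
        hb := fun i => (hL.1 _ (L.get_mem i)).2.2.1
        hy := fun i => (hL.1 _ (L.get_mem i)).2.2.2
        disj := fun i j hij => hij.lt_or_gt.elim (hdisj i j) fun h => (hdisj j i h).symm }
    refine le_trans (le_of_eq ?_) (le_iSup₂ (f := fun n P => sharpSum (n := n) Λ m f P) _ P)
    conv_lhs => rw [← List.ofFn_get L]
    rw [weightedSum_ofFn]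
    exact Finset.sum_congr rfl fun i _ => (hterm _ _).symm

section Power

variable {γ : ℝ}

theorem invWeight_rpow_ne_zero (m : ℕ) : invWeight (fun n => (n : ℝ) ^ γ) m ≠ 0 := by
  rw [invWeight, ne_eq, ENNReal.ofReal_eq_zero, not_le]
  positivity

theorem antitone_invWeight_rpow (hγ : 0 ≤ γ) : Antitone (invWeight fun n => (n : ℝ) ^ γ) := by
  intro m m' h
  simp only [invWeight]
  gcongr

theorem tendsto_invWeight_rpow (hγ : 0 < γ) :
    Tendsto (invWeight fun n => (n : ℝ) ^ γ) atTop (nhds 0) := by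
  have h : Tendsto (fun m : ℕ => (((m + 1 : ℕ) : ℝ) ^ γ)⁻¹) atTop (nhds 0) :=
    ((tendsto_rpow_atTop hγ).comp (tendsto_natCast_atTop_atTop.comp
      (tendsto_add_atTop_nat 1))).inv_tendsto_atTop
  rw [← ENNReal.ofReal_zero]
  exact ENNReal.tendsto_ofReal h

theorem mul_invWeight_rpow_le (hγ : 0 ≤ γ) (M : ℕ) (hM : 1 ≤ M) :
    ENNReal.ofReal ((3 / 2) ^ γ) * invWeight (fun n => (n : ℝ) ^ γ) (2 * M) ≤
      invWeight (fun n => (n : ℝ) ^ γ) M := by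
  have hM' : (1 : ℝ) ≤ M := by exact_mod_cast hM
  unfold invWeight
  rw [← ENNReal.ofReal_mul (by positivity)]
  apply ENNReal.ofReal_le_ofReal
  rw [← div_eq_mul_inv, div_le_iff₀ (by positivity), inv_mul_eq_div,
    le_div_iff₀ (by positivity), ← Real.mul_rpow (by positivity) (by positivity)]
  apply Real.rpow_le_rpow (by positivity) _ hγ
  push_cast
  linarith

end Power

theorem tendsto_sharpV1_rpow {γ : ℝ} (hγ : 0 < γ) {f : ℝ → ℝ → ℝ}
    (hf : sharpV1 (fun n => (n : ℝ) ^ γ) 0 f ≠ ⊤) :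
    Tendsto (fun m => sharpV1 (fun n => (n : ℝ) ^ γ) m f) atTop (nhds 0) := by
  simp only [sharpV1_eq_listVar] at hf ⊢
  refine tendsto_listVar_zero (antitone_invWeight_rpow hγ.le) (invWeight_rpow_ne_zero 0)
    (tendsto_invWeight_rpow hγ) ?_ (mul_invWeight_rpow_le hγ.le) hf
  rw [ENNReal.one_lt_ofReal]
  exact Real.one_lt_rpow (by norm_num) hγ

theorem sharpV1_rpow_zero_ne_top {γ : ℝ} {f : ℝ → ℝ → ℝ} {m : ℕ}
    (hf : sharpV1 (fun n => (n : ℝ) ^ γ) m f ≠ ⊤) :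
    sharpV1 (fun n => (n : ℝ) ^ γ) 0 f ≠ ⊤ := by
  rw [sharpV1_eq_listVar] at hf ⊢
  exact listVar_zero_ne_top invWeight_rpow_ne_zero (fun _ => ENNReal.ofReal_ne_top) hf

/-- For `0 < γ ≤ 1`, `{n^γ}^# V = C {n^γ}^# V`. -/
theorem stmt1 (γ : ℝ) (hγ0 : 0 < γ) (hγ1 : γ ≤ 1) :
    ∀ f : ℝ → ℝ → ℝ,
      SharpBV (fun n => (n : ℝ) ^ γ) f ↔ CSharpV (fun n => (n : ℝ) ^ γ) f := by
  intro f
  unfold SharpBV CSharpV sharpV sharpV2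
  constructor
  · intro h
    rw [ENNReal.add_ne_top] at h
    simpa using (tendsto_sharpV1_rpow hγ0 h.1).add (tendsto_sharpV1_rpow hγ0 h.2)
  · intro h
    obtain ⟨m, hm⟩ := (h.eventually_lt_const ENNReal.zero_lt_top).exists
    obtain ⟨h₁, h₂⟩ := ENNReal.add_ne_top.1 hm.ne
    exact ENNReal.add_ne_top.2 ⟨sharpV1_rpow_zero_ne_top h₁, sharpV1_rpow_zero_ne_top h₂⟩
end

section
/- For every α ∈ (0,1) there is a constant c(α) > 0 such that for every N ∈ ℕ and every m with 1 ≤ m ≤ N, ∫_{2^{m−N−1}}^{2^{m−N}} |K_{2^N}^{−α}(x)| dx ≥ c(α) · 2^{mα}, where K_n^{−α} is the Cesàro kernel of order −α for the Walsh system. -/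
open MeasureTheory Filter Set ENNReal

section Cesaro

open Finset

lemma Acoef_zero (γ : ℝ) : Acoef γ 0 = 1 := by simp [Acoef]

lemma Acoef_succ (γ : ℝ) (n : ℕ) :
    Acoef γ (n + 1) = Acoef γ n * ((γ + n + 1) / (n + 1)) := by
  have h : (n.factorial : ℝ) ≠ 0 := by positivity
  have h' : (n : ℝ) + 1 ≠ 0 := by positivity
  simp only [Acoef, prod_range_succ, Nat.factorial_succ, Nat.cast_mul, Nat.cast_add, Nat.cast_one]
  field_simp

lemma Acoef_succ_eq_add (γ : ℝ) (n : ℕ) :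
    Acoef γ (n + 1) = Acoef γ n + Acoef (γ - 1) (n + 1) := by
  have h : (n.factorial : ℝ) ≠ 0 := by positivity
  have h' : (n : ℝ) + 1 ≠ 0 := by positivity
  have e : Acoef (γ - 1) (n + 1) = Acoef γ n * (γ / (n + 1)) := by
    have hp : ∏ k ∈ range n, (γ - 1 + ((k + 1 : ℕ) : ℝ) + 1) = ∏ k ∈ range n, (γ + k + 1) :=
      prod_congr rfl fun k _ => by push_cast; ring
    rw [Acoef, Acoef, prod_range_succ', hp, Nat.factorial_succ]
    push_cast
    field_simp
    ring
  rw [e, Acoef_succ]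
  field_simp
  ring

lemma Acoef_pos {γ : ℝ} (hγ : -1 < γ) (n : ℕ) : 0 < Acoef γ n :=
  div_pos (prod_pos fun k _ => by linarith [(Nat.cast_nonneg k : (0 : ℝ) ≤ k)]) (by positivity)

lemma Acoef_neg_antitone {α : ℝ} (hα : α ∈ Set.Ioo (0 : ℝ) 1) : Antitone (Acoef (-α)) := by
  refine antitone_nat_of_succ_le fun n => ?_
  rw [Acoef_succ]
  refine mul_le_of_le_one_right (Acoef_pos (by linarith [hα.2]) n).le ?_
  rw [div_le_one (by positivity)]
  linarith [hα.1]

/-- The sequence `A_n^{-α} (n+1)^α` is nonincreasing. -/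
lemma Acoef_neg_mul_rpow_antitone {α : ℝ} (hα : α ∈ Set.Ioo (0 : ℝ) 1) :
    Antitone fun n : ℕ => Acoef (-α) n * ((n : ℝ) + 1) ^ α := by
  refine antitone_nat_of_succ_le fun n => ?_
  have hn : (0 : ℝ) < (n : ℝ) + 1 := by positivity
  have hA := (Acoef_pos (by linarith [hα.2] : -1 < -α) n).le
  have hbern : (1 + 1 / ((n : ℝ) + 1)) ^ α ≤ 1 + α * (1 / ((n : ℝ) + 1)) :=
    rpow_one_add_le_one_add_mul_self (by linarith [one_div_pos.2 hn]) hα.1.le hα.2.le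
  have hsplit : ((n + 1 : ℕ) : ℝ) + 1 = ((n : ℝ) + 1) * (1 + 1 / ((n : ℝ) + 1)) := by
    push_cast; field_simp
  have hle1 : (1 / ((n : ℝ) + 1)) ≤ 1 := by
    rw [div_le_one hn]; linarith [(Nat.cast_nonneg n : (0 : ℝ) ≤ n)]
  set t := 1 / ((n : ℝ) + 1) with ht
  have ht0 : 0 < t := one_div_pos.2 hn
  have hfac : (-α + n + 1) / ((n : ℝ) + 1) = 1 - α * t := by
    rw [ht]; field_simp; ring
  have hαt : α * t ≤ 1 := by nlinarith [hα.1, hα.2]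
  change Acoef (-α) (n + 1) * (((n + 1 : ℕ) : ℝ) + 1) ^ α ≤ Acoef (-α) n * ((n : ℝ) + 1) ^ α
  rw [Acoef_succ, hfac, hsplit, Real.mul_rpow hn.le (by linarith)]
  have hkey : (1 - α * t) * (1 + t) ^ α ≤ 1 := by
    calc (1 - α * t) * (1 + t) ^ α ≤ (1 - α * t) * (1 + α * t) :=
          mul_le_mul_of_nonneg_left hbern (by linarith)
      _ ≤ 1 := by nlinarith [sq_nonneg (α * t)]
  have hpos : 0 ≤ Acoef (-α) n * ((n : ℝ) + 1) ^ α := by positivity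
  calc _ = Acoef (-α) n * ((n : ℝ) + 1) ^ α * ((1 - α * t) * (1 + t) ^ α) := by ring
    _ ≤ _ := mul_le_of_le_one_right hpos hkey

/-- Shifting the index by at least itself contracts `A^{-α}` by the factor `2^{-α}`. -/
lemma Acoef_neg_add_le {α : ℝ} (hα : α ∈ Set.Ioo (0 : ℝ) 1) {r p : ℕ} (hr : r < p) :
    Acoef (-α) (p + r) ≤ (2 : ℝ) ^ (-α) * Acoef (-α) r := by
  have h := Acoef_neg_mul_rpow_antitone hα (Nat.le_add_left r p)
  have hA := (Acoef_pos (by linarith [hα.2] : -1 < -α) (p + r)).le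
  have hr' : (r : ℝ) + 1 ≤ p := by exact_mod_cast hr
  have hr0 : (0 : ℝ) < (r : ℝ) + 1 := by positivity
  have h2 : (2 : ℝ) ^ α * ((r : ℝ) + 1) ^ α ≤ (((p + r : ℕ) : ℝ) + 1) ^ α := by
    rw [← Real.mul_rpow (by norm_num) hr0.le]
    refine Real.rpow_le_rpow (by positivity) ?_ hα.1.le
    push_cast; linarith
  have hrp : 0 < ((r : ℝ) + 1) ^ α := by positivity
  have h3 : Acoef (-α) (p + r) * (2 : ℝ) ^ α ≤ Acoef (-α) r := by
    refine le_of_mul_le_mul_right ?_ hrp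
    calc _ = Acoef (-α) (p + r) * ((2 : ℝ) ^ α * ((r : ℝ) + 1) ^ α) := by ring
      _ ≤ Acoef (-α) (p + r) * (((p + r : ℕ) : ℝ) + 1) ^ α := mul_le_mul_of_nonneg_left h2 hA
      _ ≤ _ := h
  rw [Real.rpow_neg (by norm_num), ← div_eq_inv_mul, le_div_iff₀ (by positivity)]
  exact h3

/-- The kernel as a weighted sum of Walsh functions. -/
lemma cesaroKernel_eq_sum_walsh (γ : ℝ) (n : ℕ) (x : ℝ) :
    cesaroKernel γ n x =
      (Acoef γ (n - 1))⁻¹ * ∑ j ∈ range n, Acoef γ (n - 1 - j) * walsh j x := by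
  rw [cesaroKernel]
  congr 1
  have hrefl (f : ℕ → ℝ) : ∑ k ∈ Icc 1 n, Acoef (γ - 1) (n - k) * f k
      = ∑ i ∈ range n, Acoef (γ - 1) i * f (n - i) := by
    refine sum_nbij' (n - ·) (n - ·) ?_ ?_ ?_ ?_ fun k hk => ?_
    any_goals intro k hk; simp only [Finset.mem_Icc, Finset.mem_range] at hk ⊢; omega
    rw [Nat.sub_sub_self (Finset.mem_Icc.1 hk).2]
  rw [hrefl]
  clear hrefl
  induction n with
  | zero => simp
  | succ n ih =>
    have hF : ∑ i ∈ range (n + 1), Acoef (γ - 1) i * walshDirichlet (n + 1 - i) x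
        = ∑ i ∈ range n, Acoef (γ - 1) i * walshDirichlet (n - i) x
          + ∑ i ∈ range (n + 1), Acoef (γ - 1) i * walsh (n - i) x := by
      have h0 : ∑ i ∈ range n, Acoef (γ - 1) i * walshDirichlet (n - i) x
          = ∑ i ∈ range (n + 1), Acoef (γ - 1) i * walshDirichlet (n - i) x := by
        rw [sum_range_succ]; simp [walshDirichlet]
      rw [h0, ← sum_add_distrib]
      refine sum_congr rfl fun i hi => ?_
      rw [Nat.succ_sub (Nat.lt_succ_iff.1 (mem_range.1 hi)), ← mul_add]
      simp only [walshDirichlet, sum_range_succ, Nat.succ_eq_add_one]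
    have hrefl : ∑ i ∈ range (n + 1), Acoef (γ - 1) i * walsh (n - i) x
        = ∑ j ∈ range (n + 1), Acoef (γ - 1) (n - j) * walsh j x := by
      rw [← sum_range_reflect]
      refine sum_congr rfl fun j hj => ?_
      have := mem_range.1 hj
      rw [show n + 1 - 1 - j = n - j by omega, show n - (n - j) = j by omega]
    rw [hF, ih, hrefl, sum_range_succ, sum_range_succ _ n, ← add_assoc, ← sum_add_distrib]
    congr 1
    · refine sum_congr rfl fun j hj => ?_
      obtain ⟨d, rfl⟩ := Nat.exists_eq_add_of_lt (mem_range.1 hj)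
      rw [show j + d + 1 - 1 - j = d by omega, show j + d + 1 - j = d + 1 by omega,
        show j + d + 1 + 1 - 1 - j = d + 1 by omega, Acoef_succ_eq_add γ d]
      ring
    · simp [Acoef_zero]

lemma r0_mul_self (x : ℝ) : r0 x * r0 x = 1 := by
  unfold r0; split_ifs <;> norm_num

lemma r0_add_half (x : ℝ) : r0 (x + 1 / 2) = -r0 x := by
  have h1 := Int.fract_nonneg x
  have h2 := Int.fract_lt_one x
  have hx := Int.floor_add_fract x
  unfold r0
  by_cases h : Int.fract x < 1 / 2
  · have : Int.fract (x + 1 / 2) = Int.fract x + 1 / 2 := by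
      rw [Int.fract_eq_iff]
      exact ⟨by linarith, by linarith, ⌊x⌋, by linarith⟩
    rw [if_pos h, if_neg (by linarith)]
  · have : Int.fract (x + 1 / 2) = Int.fract x - 1 / 2 := by
      rw [Int.fract_eq_iff]
      exact ⟨by linarith, by linarith, ⌊x⌋ + 1, by push_cast; linarith⟩
    rw [if_neg h, if_pos (by linarith), neg_neg]

lemma r0_periodic : Function.Periodic r0 1 := fun x => by simp [r0]

lemma measurable_r0 : Measurable r0 :=
  Measurable.ite (measurableSet_lt measurable_fract measurable_const)
    measurable_const measurable_const

lemma walsh_zero (x : ℝ) : walsh 0 x = 1 := by simp [walsh]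

lemma walsh_eq_prod_of_le {k M : ℕ} (h : k ≤ M) (x : ℝ) :
    walsh k x = ∏ j ∈ range M, if k.testBit j then r0 (2 ^ j * x) else 1 := by
  refine prod_subset (range_mono h) fun j _ hj => if_neg ?_
  have : k < 2 ^ j := lt_of_le_of_lt (by simpa using hj) Nat.lt_two_pow_self
  simp [Nat.testBit_lt_two_pow this]

/-- Splitting off the lowest binary digit of the index. -/
lemma walsh_eq_mul_walsh_div_two (k : ℕ) (x : ℝ) :
    walsh k x = (if k % 2 = 1 then r0 x else 1) * walsh (k / 2) (2 * x) := by
  rw [walsh_eq_prod_of_le (Nat.le_succ k), prod_range_succ', mul_comm,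
    walsh_eq_prod_of_le (Nat.div_le_self k 2)]
  congr 1
  · simp [Nat.testBit_zero]
  · refine prod_congr rfl fun j _ => ?_
    rw [Nat.testBit_succ, pow_succ, mul_assoc]

lemma walsh_mul_self (k : ℕ) (x : ℝ) : walsh k x * walsh k x = 1 := by
  rw [walsh, ← prod_mul_distrib]
  refine prod_eq_one fun j _ => ?_
  split_ifs
  · exact r0_mul_self _
  · norm_num

lemma abs_walsh (k : ℕ) (x : ℝ) : |walsh k x| = 1 := by
  rcases mul_self_eq_one_iff.1 (walsh_mul_self k x) with h | h <;> simp [h]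

lemma measurable_walsh (k : ℕ) : Measurable (walsh k) := by
  refine Finset.measurable_fun_prod _ fun j _ => ?_
  split_ifs
  · exact measurable_r0.comp (measurable_const_mul _)
  · exact measurable_const

lemma intervalIntegrable_walsh (k : ℕ) (a b : ℝ) : IntervalIntegrable (walsh k) volume a b := by
  refine (intervalIntegrable_const (c := (1 : ℝ))).mono_fun
    (measurable_walsh k).aestronglyMeasurable (Eventually.of_forall fun x => ?_)
  simp [abs_walsh]

lemma walsh_periodic (k : ℕ) : Function.Periodic (walsh k) 1 := fun x => by
  unfold walsh
  refine prod_congr rfl fun j _ => ?_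
  have h := r0_periodic.nat_mul (2 ^ j) (2 ^ j * x)
  push_cast at h
  rw [mul_add, h]

lemma exists_antiperiodic_walsh {k : ℕ} (hk : k ≠ 0) :
    ∃ h : ℝ, Function.Antiperiodic (walsh k) h := by
  induction k using Nat.strong_induction_on with
  | _ k ih =>
    rcases Nat.mod_two_eq_zero_or_one k with h0 | h1
    · obtain ⟨h, hh⟩ := ih (k / 2) (by omega) (by omega)
      refine ⟨h / 2, fun x => ?_⟩
      rw [walsh_eq_mul_walsh_div_two, walsh_eq_mul_walsh_div_two k x, mul_add,
        mul_div_cancel₀ h two_ne_zero, hh]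
      simp [h0]
    · refine ⟨1 / 2, fun x => ?_⟩
      rw [walsh_eq_mul_walsh_div_two, walsh_eq_mul_walsh_div_two k x, mul_add,
        mul_one_div_cancel two_ne_zero, walsh_periodic, r0_add_half]
      simp [h1]

/-- Splitting off the `t` lowest binary digits of the index. -/
lemma walsh_eq_walsh_mod_mul_walsh_div (t k : ℕ) (x : ℝ) :
    walsh k x = walsh (k % 2 ^ t) x * walsh (k / 2 ^ t) (2 ^ t * x) := by
  induction t generalizing k x with
  | zero => simp [Nat.mod_one, walsh_zero]
  | succ t ih =>
    have e1 : k % 2 ^ (t + 1) % 2 = k % 2 :=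
      Nat.mod_mod_of_dvd _ (dvd_pow_self 2 t.succ_ne_zero)
    have e2 : k % 2 ^ (t + 1) / 2 = k / 2 % 2 ^ t := by
      rw [pow_succ', Nat.mod_mul_right_div_self]
    rw [walsh_eq_mul_walsh_div_two, ih, walsh_eq_mul_walsh_div_two (k % 2 ^ (t + 1)), e1, e2,
      Nat.div_div_eq_div_mul, ← pow_succ', ← mul_assoc (2 ^ t : ℝ), ← pow_succ, mul_assoc]

/-- Complementing the binary digits of the index. -/
lemma walsh_complement {N j : ℕ} (hj : j < 2 ^ N) (x : ℝ) :
    walsh (2 ^ N - 1 - j) x = walsh (2 ^ N - 1) x * walsh j x := by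
  induction N generalizing j x with
  | zero =>
    obtain rfl : j = 0 := by simpa using hj
    simp [walsh_zero]
  | succ N ih =>
    rw [pow_succ] at hj ⊢
    have hN : 0 < 2 ^ N := by positivity
    rw [walsh_eq_mul_walsh_div_two, walsh_eq_mul_walsh_div_two (2 ^ N * 2 - 1),
      walsh_eq_mul_walsh_div_two j,
      show (2 ^ N * 2 - 1 - j) / 2 = 2 ^ N - 1 - j / 2 by omega,
      show (2 ^ N * 2 - 1) / 2 = 2 ^ N - 1 by omega, ih (by omega),
      show (2 ^ N * 2 - 1) % 2 = 1 by omega]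
    rcases Nat.mod_two_eq_zero_or_one j with h | h
    · rw [show (2 ^ N * 2 - 1 - j) % 2 = 1 by omega, h]
      simp; ring
    · rw [show (2 ^ N * 2 - 1 - j) % 2 = 0 by omega, h]
      simp
      linear_combination (-walsh (2 ^ N - 1) (2 * x) * walsh (j / 2) (2 * x)) * r0_mul_self x

/-- The Walsh functions of index below `2^{s+1}` are constant on `(2^{-s-1}, 2^{-s})`. -/
lemma walsh_eq_on_dyadic {s k : ℕ} (hk : k < 2 ^ (s + 1)) {x : ℝ}
    (hx : x ∈ Set.Ioo ((1 / 2 : ℝ) ^ (s + 1)) ((1 / 2) ^ s)) :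
    walsh k x = if k < 2 ^ s then 1 else -1 := by
  induction s generalizing k x with
  | zero =>
    obtain ⟨h1, h2⟩ := hx
    norm_num at h1 h2
    have hr : r0 x = -1 := by
      rw [r0, Int.fract_eq_self.2 ⟨by linarith, h2⟩, if_neg (by linarith)]
    rw [walsh_eq_mul_walsh_div_two, hr]
    interval_cases k <;> simp [walsh_zero]
  | succ s ih =>
    obtain ⟨h1, h2⟩ := hx
    have hs : (1 / 2 : ℝ) ^ (s + 1) ≤ 1 / 2 := by
      rw [pow_succ]
      have : (1 / 2 : ℝ) ^ s ≤ 1 := pow_le_one₀ (by norm_num) (by norm_num)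
      linarith
    have hpos : (0 : ℝ) < (1 / 2) ^ (s + 1 + 1) := by positivity
    have hr : r0 x = 1 := by
      rw [r0, Int.fract_eq_self.2 ⟨by linarith, by linarith⟩, if_pos (by linarith)]
    rw [walsh_eq_mul_walsh_div_two, hr, ite_self, one_mul, ih (k := k / 2)]
    · have : k / 2 < 2 ^ s ↔ k < 2 ^ (s + 1) := by rw [pow_succ]; omega
      simp only [this]
    · rw [pow_succ] at hk; omega
    · constructor
      · rw [pow_succ] at h1; linarith
      · rw [pow_succ] at h2; linarith

lemma integral_eq_zero_of_periodic_of_antiperiodic {f : ℝ → ℝ} {T h : ℝ}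
    (hT : Function.Periodic f T) (hh : Function.Antiperiodic f h) (a : ℝ) :
    ∫ x in a..a + T, f x = 0 := by
  have h1 : ∫ x in a..a + T, f (x + h) = ∫ x in a..a + T, f x := by
    rw [intervalIntegral.integral_comp_add_right, add_right_comm,
      hT.intervalIntegral_add_eq (a + h) a]
  have h2 : ∫ x in a..a + T, f (x + h) = -∫ x in a..a + T, f x := by
    rw [← intervalIntegral.integral_neg]
    exact intervalIntegral.integral_congr fun x _ => hh x
  linarith

lemma integral_walsh_dyadic (s k : ℕ) :
    ∫ x in ((1 / 2 : ℝ) ^ (s + 1))..((1 / 2) ^ s), walsh k x =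
      if k < 2 ^ s then (1 / 2) ^ (s + 1) else if k < 2 ^ (s + 1) then -(1 / 2) ^ (s + 1) else 0 := by
  have hlen : (1 / 2 : ℝ) ^ s = (1 / 2) ^ (s + 1) + (1 / 2) ^ (s + 1) := by ring
  have hle : (1 / 2 : ℝ) ^ (s + 1) ≤ (1 / 2) ^ s := by
    rw [hlen]; exact le_add_of_nonneg_left (by positivity)
  have hpow : 2 ^ s < 2 ^ (s + 1) := Nat.pow_lt_pow_succ (by norm_num)
  have hmod : k % 2 ^ (s + 1) < 2 ^ (s + 1) := Nat.mod_lt _ (by positivity)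
  have key : ∫ x in ((1 / 2 : ℝ) ^ (s + 1))..((1 / 2) ^ s), walsh k x =
      (if k % 2 ^ (s + 1) < 2 ^ s then 1 else -1) *
        ∫ x in ((1 / 2 : ℝ) ^ (s + 1))..((1 / 2) ^ s), walsh (k / 2 ^ (s + 1)) (2 ^ (s + 1) * x) := by
    rw [← intervalIntegral.integral_const_mul]
    refine intervalIntegral.integral_congr_Ioo_of_le hle fun x hx => ?_
    rw [walsh_eq_walsh_mod_mul_walsh_div (s + 1), walsh_eq_on_dyadic hmod hx]
  rw [key]
  by_cases hk : k < 2 ^ (s + 1)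
  · simp only [Nat.div_eq_of_lt hk, Nat.mod_eq_of_lt hk, walsh_zero,
      intervalIntegral.integral_const, smul_eq_mul, mul_one]
    split_ifs <;> linarith
  · rw [if_neg (c := k < 2 ^ s) (fun h => hk (h.trans hpow)), if_neg hk, hlen]
    obtain ⟨h, hh⟩ := exists_antiperiodic_walsh
      (Nat.div_pos (not_lt.1 hk) (by positivity)).ne'
    have hc : (2 : ℝ) ^ (s + 1) ≠ 0 := by positivity
    rw [integral_eq_zero_of_periodic_of_antiperiodic (h := (2 ^ (s + 1))⁻¹ * h), mul_zero]
    · intro x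
      simp only
      rw [mul_add, ← mul_pow, mul_one_div_cancel two_ne_zero, one_pow, walsh_periodic]
    · intro x
      simp only
      rw [mul_add, mul_inv_cancel_left₀ hc, hh]

/-- Up to a sign, `K_{2^N}^γ` is the Walsh polynomial with coefficients `A_j^γ / A_{2^N-1}^γ`. -/
lemma sum_le_abs_cesaroKernel {γ : ℝ} (N : ℕ) (x : ℝ) :
    (Acoef γ (2 ^ N - 1))⁻¹ * ∑ j ∈ range (2 ^ N), Acoef γ j * walsh j x ≤
      |cesaroKernel γ (2 ^ N) x| := by
  have h : cesaroKernel γ (2 ^ N) x = walsh (2 ^ N - 1) x *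
      ((Acoef γ (2 ^ N - 1))⁻¹ * ∑ j ∈ range (2 ^ N), Acoef γ j * walsh j x) := by
    rw [cesaroKernel_eq_sum_walsh, ← sum_range_reflect, mul_left_comm, mul_sum (a := walsh _ x)]
    congr 1
    refine sum_congr rfl fun j hj => ?_
    have hj' := mem_range.1 hj
    rw [walsh_complement hj', Nat.sub_sub_self (by omega)]
    ring
  rw [h, abs_mul, abs_walsh, one_mul]
  exact le_abs_self _

lemma intervalIntegrable_sum_walsh (c : ℕ → ℝ) (n : ℕ) (a b : ℝ) :
    IntervalIntegrable (fun x => ∑ j ∈ range n, c j * walsh j x) volume a b := by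
  simpa only [← Finset.sum_fn] using
    IntervalIntegrable.sum (range n) fun j _ => (intervalIntegrable_walsh j a b).const_mul (c j)

lemma intervalIntegrable_cesaroKernel (γ : ℝ) (n : ℕ) (a b : ℝ) :
    IntervalIntegrable (cesaroKernel γ n) volume a b := by
  simp only [funext (cesaroKernel_eq_sum_walsh γ n)]
  exact (intervalIntegrable_sum_walsh _ n a b).const_mul _

lemma sum_Acoef_mul_integral_walsh_ge {α : ℝ} (hα : α ∈ Set.Ioo (0 : ℝ) 1) {s N : ℕ} (h : s < N) :
    (1 - (2 : ℝ) ^ (-α)) / 2 * Acoef (-α) (2 ^ s - 1) ≤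
      ∑ j ∈ range (2 ^ N), Acoef (-α) j *
        ∫ x in ((1 / 2 : ℝ) ^ (s + 1))..((1 / 2) ^ s), walsh j x := by
  have hpow : 2 ^ (s + 1) ≤ 2 ^ N := Nat.pow_le_pow_right (by norm_num) h
  obtain ⟨d, hd⟩ := Nat.exists_eq_add_of_le hpow
  have h2 : 2 ^ (s + 1) = 2 ^ s + 2 ^ s := by ring
  have hs : 0 < 2 ^ s := by positivity
  have hc : (2 : ℝ) ^ (-α) ≤ 1 := Real.rpow_le_one_of_one_le_of_nonpos (by norm_num)
    (by linarith [hα.1])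
  have hT : (0 : ℝ) < (1 / 2) ^ (s + 1) := by positivity
  have hsum : ∑ j ∈ range (2 ^ N), Acoef (-α) j *
        ∫ x in ((1 / 2 : ℝ) ^ (s + 1))..((1 / 2) ^ s), walsh j x =
      (1 / 2) ^ (s + 1) *
        ∑ r ∈ range (2 ^ s), (Acoef (-α) r - Acoef (-α) (2 ^ s + r)) := by
    rw [hd, sum_range_add, h2, sum_range_add, ← h2, mul_sum, ← sum_add_distrib]
    rw [sum_eq_zero (s := range d), add_zero]
    · refine sum_congr rfl fun r hr => ?_
      have := mem_range.1 hr
      rw [integral_walsh_dyadic, integral_walsh_dyadic, if_pos this, if_neg (by omega),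
        if_pos (by omega)]
      ring
    · intro r _
      rw [integral_walsh_dyadic, if_neg (by omega), if_neg (by omega), mul_zero]
  have hterm : ∀ r ∈ range (2 ^ s), (1 - (2 : ℝ) ^ (-α)) * Acoef (-α) (2 ^ s - 1) ≤
      Acoef (-α) r - Acoef (-α) (2 ^ s + r) := fun r hr => by
    have hr' := mem_range.1 hr
    have h1 := Acoef_neg_add_le hα hr'
    have h3 := Acoef_neg_antitone hα (show r ≤ 2 ^ s - 1 by omega)
    have h4 := mul_le_mul_of_nonneg_left h3 (sub_nonneg.2 hc)
    linarith
  have hcard := card_nsmul_le_sum _ _ _ hterm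
  rw [card_range, nsmul_eq_mul, Nat.cast_pow, Nat.cast_ofNat] at hcard
  rw [hsum]
  refine le_trans (le_of_eq ?_) (mul_le_mul_of_nonneg_left hcard hT.le)
  have : (1 / 2 : ℝ) ^ (s + 1) * 2 ^ s = 1 / 2 := by
    rw [pow_succ, mul_right_comm, ← mul_pow]; norm_num
  rw [← mul_assoc, this]
  ring

lemma rpow_mul_Acoef_le {α : ℝ} (hα : α ∈ Set.Ioo (0 : ℝ) 1) (s m : ℕ) :
    (2 : ℝ) ^ ((m : ℝ) * α) * Acoef (-α) (2 ^ (m + s) - 1) ≤ Acoef (-α) (2 ^ s - 1) := by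
  have hcast (t : ℕ) : ((2 ^ t - 1 : ℕ) : ℝ) + 1 = 2 ^ t := by
    rw [Nat.cast_sub Nat.one_le_two_pow]; push_cast; ring
  have h := Acoef_neg_mul_rpow_antitone hα
    (Nat.sub_le_sub_right (Nat.pow_le_pow_right two_pos (Nat.le_add_left s m)) 1)
  simp only [hcast] at h
  rw [pow_add (2 : ℝ), Real.mul_rpow (by positivity) (by positivity), ← mul_assoc] at h
  have h' := le_of_mul_le_mul_right h (by positivity)
  rwa [Real.rpow_mul two_pos.le, Real.rpow_natCast, mul_comm]

end Cesaro

/-- `∫_{2^{m-N-1}}^{2^{m-N}} |K_{2^N}^{-α}| ≥ c(α) 2^{mα}` for `1 ≤ m ≤ N`. -/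
theorem stmt10 (α : ℝ) (hα : α ∈ Ioo (0 : ℝ) 1) :
    ∃ c : ℝ, 0 < c ∧ ∀ N m : ℕ, 1 ≤ m → m ≤ N →
      c * (2 : ℝ) ^ ((m : ℝ) * α) ≤
        ∫ x in ((2 : ℝ) ^ ((m : ℝ) - (N : ℝ) - 1))..((2 : ℝ) ^ ((m : ℝ) - (N : ℝ))),
          |cesaroKernel (-α) (2 ^ N) x| := by
  have hc : (2 : ℝ) ^ (-α) < 1 :=
    Real.rpow_lt_one_of_one_lt_of_neg (by norm_num) (by linarith [hα.1])
  refine ⟨(1 - (2 : ℝ) ^ (-α)) / 2, by linarith, fun N m hm hmN => ?_⟩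
  obtain ⟨s, rfl⟩ := Nat.exists_eq_add_of_le hmN
  have hb : (2 : ℝ) ^ ((m : ℝ) - ((m + s : ℕ) : ℝ)) = (1 / 2) ^ s := by
    rw [Nat.cast_add, sub_add_cancel_left, Real.rpow_neg two_pos.le, Real.rpow_natCast,
      one_div, inv_pow]
  have ha : (2 : ℝ) ^ ((m : ℝ) - ((m + s : ℕ) : ℝ) - 1) = (1 / 2) ^ (s + 1) := by
    rw [Real.rpow_sub_one two_ne_zero, hb, pow_succ]; ring
  rw [ha, hb]
  have hA := Acoef_pos (by linarith [hα.2] : -1 < -α) (2 ^ (m + s) - 1)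
  have hle : (1 / 2 : ℝ) ^ (s + 1) ≤ (1 / 2) ^ s :=
    pow_le_pow_of_le_one (by norm_num) (by norm_num) (Nat.le_succ s)
  have hint (j : ℕ) : IntervalIntegrable (fun x => Acoef (-α) j * walsh j x) volume
      ((1 / 2 : ℝ) ^ (s + 1)) ((1 / 2) ^ s) := (intervalIntegrable_walsh j _ _).const_mul _
  refine le_trans ?_ (intervalIntegral.integral_mono_on hle
    ((intervalIntegrable_sum_walsh _ _ _ _).const_mul _)
    (intervalIntegrable_cesaroKernel (-α) (2 ^ (m + s)) _ _).abs
    fun x _ => sum_le_abs_cesaroKernel (m + s) x)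
  rw [intervalIntegral.integral_const_mul,
    intervalIntegral.integral_finsetSum fun j _ => hint j]
  simp only [intervalIntegral.integral_const_mul]
  rw [← div_eq_inv_mul, le_div_iff₀ hA, mul_assoc]
  exact (mul_le_mul_of_nonneg_left (rpow_mul_Acoef_le hα s m) (by linarith)).trans
    (sum_Acoef_mul_integral_walsh_ge hα (by omega))
end
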